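/- arXiv:2205.08744 — 5 statements merged into one kernel-verified Lean document; each statement's English description precedes it below -/
import Mathlib

section
/- The quotient of ℝ³ by the equivalence relation identifying q and q' whenever q' = γ⋆q for some γ ∈ Γ, where Γ = {(√(2π)·a, √(2π)·b, π·c) : a,b,c ∈ ℤ} and ⋆ is the Heisenberg product, is a compact topological space (i.e. Γ is a co-compact subgroup of H₃). -/
/-- The Heisenberg product on `ℝ³`. -/
noncomputable def heisMul (p q : ℝ × ℝ × ℝ) : ℝ × ℝ × ℝ :=
  (p.1 + q.1, p.2.1 + q.2.1, p.2.2 + q.2.2 + (1/2) * (p.1 * q.2.1 - p.2.1 * q.1))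

/-- The lattice `Γ = (√(2π) ℤ)² × π ℤ` in the Heisenberg group. -/
def heisGamma : Set (ℝ × ℝ × ℝ) :=
  {p | ∃ a b c : ℤ, p = (Real.sqrt (2 * Real.pi) * a, Real.sqrt (2 * Real.pi) * b,
    Real.pi * c)}

/-- The relation identifying `q` and `q'` when `q' = γ ⋆ q` for some `γ ∈ Γ`. -/
def heisRel (q q' : ℝ × ℝ × ℝ) : Prop :=
  ∃ γ ∈ heisGamma, q' = heisMul γ q

/-- Every real number can be moved into `[0, s]` by an integer multiple of `s > 0`. -/
theorem exists_mul_int_add_mem_Icc {s : ℝ} (hs : 0 < s) (x : ℝ) :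
    ∃ n : ℤ, s * n + x ∈ Set.Icc 0 s := by
  obtain ⟨n, hn, -⟩ := existsUnique_add_zsmul_mem_Ico hs x 0
  rw [zsmul_eq_mul, zero_add] at hn
  exact ⟨n, by linarith [hn.1], by linarith [hn.2]⟩

/-- Every `Γ`-orbit meets the box `[0, √(2π)]² × [0, π]`. -/
theorem exists_heisMul_mem_box (q : ℝ × ℝ × ℝ) :
    ∃ γ ∈ heisGamma, heisMul γ q ∈ Set.Icc 0 (Real.sqrt (2 * Real.pi)) ×ˢ
      Set.Icc 0 (Real.sqrt (2 * Real.pi)) ×ˢ Set.Icc 0 Real.pi := by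
  have hs : 0 < Real.sqrt (2 * Real.pi) := Real.sqrt_pos.2 Real.two_pi_pos
  obtain ⟨a, ha⟩ := exists_mul_int_add_mem_Icc hs q.1
  obtain ⟨b, hb⟩ := exists_mul_int_add_mem_Icc hs q.2.1
  obtain ⟨c, hc⟩ := exists_mul_int_add_mem_Icc Real.pi_pos (q.2.2 + (1/2) *
    (Real.sqrt (2 * Real.pi) * a * q.2.1 - Real.sqrt (2 * Real.pi) * b * q.1))
  rw [← add_assoc] at hc
  exact ⟨_, ⟨a, b, c, rfl⟩, ha, hb, hc⟩

/-- `Γ` is co-compact: the quotient `Γ \ H₃`, with the quotient topology, is compact. -/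
theorem heisQuotient_compact : CompactSpace (Quot heisRel) := by
  have hK : IsCompact (Set.Icc 0 (Real.sqrt (2 * Real.pi)) ×ˢ
      Set.Icc 0 (Real.sqrt (2 * Real.pi)) ×ˢ Set.Icc 0 Real.pi) :=
    isCompact_Icc.prod (isCompact_Icc.prod isCompact_Icc)
  refine ⟨(hK.image (f := Quot.mk heisRel) continuous_quot_mk).of_isClosed_subset
    isClosed_univ ?_⟩
  rintro ⟨q⟩ -
  obtain ⟨γ, hγ, hq⟩ := exists_heisMul_mem_box q
  exact ⟨heisMul γ q, hq, (Quot.sound ⟨γ, hγ, rfl⟩).symm⟩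
end

section
/- Continuity of the mode-n solution at I = 0: let n ≥ 1 be an integer and b : ℝ → ℂ a smooth compactly supported function. Then for every z ∈ ℝ, lim_{I → 0⁺} ∫_{−∞}^0 b(z + Is/2) e^{ins} ds = b(z)/(i n). -/
open MeasureTheory Filter

lemma norm_exp_I_mul_natCast_mul_ofReal (n : ℕ) (s : ℝ) :
    ‖Complex.exp (Complex.I * n * s)‖ = 1 := by
  have h : Complex.I * n * s = ((n * s : ℝ) : ℂ) * Complex.I := by push_cast; ring
  rw [h, Complex.norm_exp_ofReal_mul_I]

lemma integrable_comp_affine {c : ℝ → ℂ} (hc : Continuous c) (hs : HasCompactSupport c)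
    (z : ℝ) {J : ℝ} (hJ : 0 < J) : Integrable fun s : ℝ => c (z + J * s / 2) := by
  have h := ((hc.integrable_of_hasCompactSupport hs (μ := volume)).comp_add_left z).comp_mul_left'
    (R := J / 2) (by positivity)
  simpa only [div_mul_eq_mul_div] using h

lemma integrable_comp_affine_mul_exp {c : ℝ → ℂ} (hc : Continuous c)
    (hs : HasCompactSupport c) (n : ℕ) (z : ℝ) {J : ℝ} (hJ : 0 < J) :
    Integrable fun s : ℝ => c (z + J * s / 2) * Complex.exp (Complex.I * n * s) := by
  refine (integrable_comp_affine hc hs z hJ).mul_bdd (c := 1)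
    (Continuous.aestronglyMeasurable (by fun_prop)) (ae_of_all _ fun s => ?_)
  exact (norm_exp_I_mul_natCast_mul_ofReal n s).le

/-- A rescaled oscillatory integral over the half-line is `O(1 / J)`. -/
lemma norm_mul_integral_Iic_comp_affine_mul_exp_le {c : ℝ → ℂ} (hc : Continuous c)
    (hs : HasCompactSupport c) (n : ℕ) (z : ℝ) {J : ℝ} (hJ : 0 < J) :
    ‖(J : ℂ) * ∫ s in Set.Iic (0 : ℝ), c (z + J * s / 2) * Complex.exp (Complex.I * n * s)‖
      ≤ 2 * ∫ x, ‖c x‖ := by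
  have h1 : ∫ s : ℝ, ‖c (z + J * s / 2)‖ = 2 / J * ∫ x, ‖c x‖ := by
    have h := Measure.integral_comp_mul_left (fun x => ‖c (z + x)‖) (J / 2)
    rw [integral_add_left_eq_self (fun x => ‖c x‖) z, inv_div, abs_of_pos (by positivity)] at h
    simpa only [div_mul_eq_mul_div, smul_eq_mul] using h
  have h2 : ‖∫ s in Set.Iic (0 : ℝ), c (z + J * s / 2) * Complex.exp (Complex.I * n * s)‖
      ≤ ∫ s : ℝ, ‖c (z + J * s / 2)‖ := by
    refine (norm_integral_le_integral_norm _).trans ?_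
    simp only [norm_mul, norm_exp_I_mul_natCast_mul_ofReal, mul_one]
    exact setIntegral_le_integral (integrable_comp_affine hc hs z hJ).norm
      (ae_of_all _ fun s => norm_nonneg _)
  rw [norm_mul, Complex.norm_real, Real.norm_of_nonneg hJ.le]
  calc _ ≤ J * (2 / J * ∫ x, ‖c x‖) := by rw [← h1]; gcongr
    _ = _ := by field_simp

/-- Integration by parts for a rescaled oscillatory integral over the half-line. -/
lemma integral_Iic_comp_affine_mul_exp {c : ℝ → ℂ} (hc : ContDiff ℝ 1 c)
    (hs : HasCompactSupport c) {n : ℕ} (hn : 1 ≤ n) (z : ℝ) {J : ℝ} (hJ : 0 < J) :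
    ∫ s in Set.Iic (0 : ℝ), c (z + J * s / 2) * Complex.exp (Complex.I * n * s)
      = c z / (Complex.I * n) - (J / 2) / (Complex.I * n) *
        ∫ s in Set.Iic (0 : ℝ), deriv c (z + J * s / 2) * Complex.exp (Complex.I * n * s) := by
  have hn0 : (n : ℂ) ≠ 0 := by exact_mod_cast (by omega : n ≠ 0)
  have hω : Complex.I * n ≠ 0 := mul_ne_zero Complex.I_ne_zero hn0
  have i0 := integrable_comp_affine_mul_exp hc.continuous hs n z hJ
  have i1 := integrable_comp_affine_mul_exp (hc.continuous_deriv le_rfl) hs.deriv n z hJ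
  have hd : ∀ s : ℝ, HasDerivAt
      (fun s : ℝ => c (z + J * s / 2) * Complex.exp (Complex.I * n * s))
      ((J / 2 : ℂ) * (deriv c (z + J * s / 2) * Complex.exp (Complex.I * n * s))
        + Complex.I * n * (c (z + J * s / 2) * Complex.exp (Complex.I * n * s))) s := by
    intro s
    have ha : HasDerivAt (fun s : ℝ => z + J * s / 2) (J / 2) s := by
      simpa using (((hasDerivAt_id s).const_mul J).div_const 2).const_add z
    have hb : HasDerivAt (fun s : ℝ => c (z + J * s / 2))
        ((J / 2) • deriv c (z + J * s / 2)) s :=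
      ((hc.differentiable one_ne_zero) _).hasDerivAt.scomp s ha
    have he : HasDerivAt (fun s : ℝ => Complex.exp (Complex.I * n * s))
        (Complex.exp (Complex.I * n * s) * (Complex.I * n)) s := by
      simpa using ((Complex.ofRealCLM.hasDerivAt (x := s)).const_mul (Complex.I * n)).cexp
    refine (hb.mul he).congr_deriv ?_
    rw [Complex.real_smul]
    push_cast
    ring
  have ht : Tendsto (fun s : ℝ => c (z + J * s / 2) * Complex.exp (Complex.I * n * s))
      atBot (nhds 0) := by
    rw [tendsto_zero_iff_norm_tendsto_zero]
    simp only [norm_mul, norm_exp_I_mul_natCast_mul_ofReal, mul_one]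
    have h := (hs.is_zero_at_infty).mono_left (atBot_le_cocompact (α := ℝ))
    have ha : Tendsto (fun s : ℝ => z + J * s / 2) atBot atBot :=
      tendsto_atBot_add_const_left _ _
        ((tendsto_id.const_mul_atBot hJ).atBot_div_const two_pos)
    simpa using (h.comp ha).norm
  have key := integral_Iic_of_hasDerivAt_of_tendsto' (a := 0) (fun s _ => hd s)
    ((i1.const_mul _).add (i0.const_mul _)).integrableOn ht
  rw [integral_add (i1.const_mul _).integrableOn (i0.const_mul _).integrableOn,
    integral_const_mul, integral_const_mul] at key
  simp only [mul_zero, zero_div, add_zero, Complex.ofReal_zero, Complex.exp_zero, mul_one,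
    sub_zero] at key
  rw [← key]
  field_simp
  ring

/-- Continuity of the mode-`n` solution at `I = 0`:
`∫_{−∞}^0 b(z + Is/2) e^{ins} ds → b(z)/(in)` as `I → 0⁺`. -/
theorem mode_n_solution_continuity (n : ℕ) (hn : 1 ≤ n)
    (b : ℝ → ℂ) (hb : ContDiff ℝ (⊤ : ℕ∞) b) (hbsupp : HasCompactSupport b) (z : ℝ) :
    Tendsto (fun J : ℝ =>
        ∫ s in Set.Iic (0 : ℝ), b (z + J * s / 2) * Complex.exp (Complex.I * n * s))
      (nhdsWithin 0 (Set.Ioi 0)) (nhds (b z / (Complex.I * n))) := by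
  have hb1 : ContDiff ℝ 1 b := hb.of_le (by exact_mod_cast le_top)
  have hb2 : ContDiff ℝ 1 (deriv b) :=
    (contDiff_infty_iff_deriv.1 hb).2.of_le (by exact_mod_cast le_top)
  set K : ℝ := 2 * ∫ x, ‖deriv (deriv b) x‖
  set M : ℝ := ‖deriv b z / (Complex.I * n)‖ + ‖1 / 2 / (Complex.I * n)‖ * K
  rw [tendsto_iff_norm_sub_tendsto_zero]
  have hlim : Tendsto (fun J : ℝ => J * (‖1 / 2 / (Complex.I * n)‖ * M))
      (nhdsWithin 0 (Set.Ioi 0)) (nhds 0) := by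
    have h : Continuous fun J : ℝ => J * (‖1 / 2 / (Complex.I * n)‖ * M) := by fun_prop
    simpa using (h.tendsto 0).mono_left nhdsWithin_le_nhds
  refine squeeze_zero' (Eventually.of_forall fun _ => norm_nonneg _) ?_ hlim
  filter_upwards [self_mem_nhdsWithin] with J hJ
  have hJ : 0 < J := hJ
  have hM : ‖∫ s in Set.Iic (0 : ℝ),
      deriv b (z + J * s / 2) * Complex.exp (Complex.I * n * s)‖ ≤ M := by
    rw [integral_Iic_comp_affine_mul_exp hb2 hbsupp.deriv hn z hJ]
    refine (norm_sub_le _ _).trans (add_le_add le_rfl ?_)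
    rw [show (J / 2 : ℂ) / (Complex.I * n) = 1 / 2 / (Complex.I * n) * J by ring, mul_assoc,
      norm_mul]
    gcongr
    exact norm_mul_integral_Iic_comp_affine_mul_exp_le (hb2.continuous_deriv le_rfl)
      hbsupp.deriv.deriv n z hJ
  rw [integral_Iic_comp_affine_mul_exp hb1 hbsupp hn z hJ, sub_sub_cancel_left, norm_neg,
    show (J / 2 : ℂ) / (Complex.I * n) = J * (1 / 2 / (Complex.I * n)) by ring, mul_assoc,
    norm_mul, norm_mul, Complex.norm_real, Real.norm_of_nonneg hJ.le]
  gcongr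
end

section
/- For every real ξ, the function x ↦ x/sinh x (extended by the value 1 at x = 0) is integrable on ℝ and ∫_ℝ (x/sinh x) e^{−iξx} dx = π²/(1 + cosh(πξ)). -/
open MeasureTheory

open Set Filter Topology

lemma norm_ofReal_mul_cexp_neg_mul {a : ℂ} {x : ℝ} (hx : 0 < x) :
    ‖(x : ℂ) * Complex.exp (-a * x)‖ = x * Real.exp (-(a.re * x)) := by
  rw [norm_mul, Complex.norm_exp, Complex.norm_of_nonneg hx.le]
  simp

lemma integrableOn_mul_exp_neg_mul {r : ℝ} (hr : 0 < r) :
    IntegrableOn (fun x : ℝ => x * Real.exp (-(r * x))) (Ioi 0) := by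
  have h := integrableOn_rpow_mul_exp_neg_mul_rpow (p := 1) (s := 1) (b := r)
    (by norm_num) one_pos hr
  simpa using h

lemma integrableOn_mul_cexp_neg_mul {a : ℂ} (ha : 0 < a.re) :
    IntegrableOn (fun x : ℝ => (x : ℂ) * Complex.exp (-a * x)) (Ioi 0) := by
  refine Integrable.mono' (integrableOn_mul_exp_neg_mul ha)
    (by fun_prop) ?_
  filter_upwards [ae_restrict_mem measurableSet_Ioi] with x hx
  exact (norm_ofReal_mul_cexp_neg_mul hx).le

lemma integral_mul_cexp_neg_mul {a : ℂ} (ha : 0 < a.re) :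
    ∫ x : ℝ in Ioi 0, (x : ℂ) * Complex.exp (-a * x) = 1 / a ^ 2 := by
  have ha0 : a ≠ 0 := by rintro rfl; simp at ha
  have hd (x : ℝ) : HasDerivAt
      (fun x : ℝ => -((x : ℂ) / a + 1 / a ^ 2) * Complex.exp (-a * x))
      ((x : ℂ) * Complex.exp (-a * x)) x := by
    have h1 : HasDerivAt (fun x : ℝ => (x : ℂ)) 1 x := Complex.ofRealCLM.hasDerivAt
    convert! ((h1.div_const a).add_const (1 / a ^ 2)).neg.mul (h1.const_mul (-a)).cexp using 1
    simp
    field_simp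
    ring
  have ht : Tendsto (fun x : ℝ => -((x : ℂ) / a + 1 / a ^ 2) * Complex.exp (-a * x))
      atTop (𝓝 0) := by
    have h1 := tendsto_rpow_mul_exp_neg_mul_atTop_nhds_zero 1 a.re ha
    have h0 := tendsto_rpow_mul_exp_neg_mul_atTop_nhds_zero 0 a.re ha
    have h2 : Tendsto (fun x : ℝ => (x : ℂ) * Complex.exp (-a * x)) atTop (𝓝 0) := by
      rw [tendsto_zero_iff_norm_tendsto_zero]
      refine h1.congr' ?_
      filter_upwards [eventually_gt_atTop 0] with x hx
      rw [norm_ofReal_mul_cexp_neg_mul hx]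
      simp
    have h3 : Tendsto (fun x : ℝ => Complex.exp (-a * x)) atTop (𝓝 0) := by
      rw [tendsto_zero_iff_norm_tendsto_zero]
      refine h0.congr fun x => ?_
      simp [Complex.norm_exp]
    convert! (h2.const_mul (-(1 / a))).add (h3.const_mul (-(1 / a ^ 2))) using 1
    · ext x; ring
    · simp
  rw [integral_Ioi_of_hasDerivAt_of_tendsto' (fun x _ => hd x)
    (integrableOn_mul_cexp_neg_mul ha) ht]
  simp

lemma hasSum_two_mul_cexp_neg {x : ℝ} (hx : 0 < x) (ξ : ℝ) :
    HasSum (fun n : ℕ => 2 * ((x : ℂ) * Complex.exp (-(2 * n + 1 + Complex.I * ξ) * x)))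
      ((x : ℂ) / (Real.sinh x : ℝ) * Complex.exp (-Complex.I * (ξ * x : ℝ))) := by
  have hr : ‖Complex.exp (-2 * x)‖ < 1 := by
    rw [Complex.norm_exp]; simp [hx]
  have h := (hasSum_geometric_of_norm_lt_one hr).mul_left
    (2 * (x : ℂ) * Complex.exp (-x) * Complex.exp (-Complex.I * (ξ * x : ℝ)))
  convert! h using 1
  · ext n
    rw [← Complex.exp_nat_mul, mul_assoc (2 * (x : ℂ)), mul_assoc (2 * (x : ℂ)), ← Complex.exp_add,
      ← Complex.exp_add, mul_assoc]
    congr 3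
    push_cast
    ring
  · have hs : (2 : ℂ) * Complex.sinh x = Complex.exp x * (1 - Complex.exp (-2 * x)) := by
      rw [Complex.two_sinh, mul_sub, ← Complex.exp_add]
      ring_nf
    have hne : 1 - Complex.exp (-2 * x) ≠ 0 := by
      intro h0
      rw [← sub_eq_zero.mp h0] at hr
      simp at hr
    have hs' : Complex.sinh x = Complex.exp x * (1 - Complex.exp (-2 * x)) / 2 := by
      rw [← hs]; ring
    rw [Complex.ofReal_sinh, hs', Complex.exp_neg]
    have := Complex.exp_ne_zero x
    field_simp

lemma summable_one_div_two_mul_add_one_sq :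
    Summable fun n : ℕ => (1 : ℝ) / (2 * n + 1) ^ 2 := by
  have h := (Real.summable_one_div_nat_pow.mpr one_lt_two).comp_injective
    (i := fun n : ℕ => 2 * n + 1) (fun a b h => by simpa using h)
  simpa [Function.comp_def] using h

lemma hasSum_integral_Ioi_div_sinh (ξ : ℝ) :
    HasSum (fun n : ℕ => 2 / (2 * n + 1 + Complex.I * ξ) ^ 2)
      (∫ x : ℝ in Ioi 0,
        (x : ℂ) / (Real.sinh x : ℝ) * Complex.exp (-Complex.I * (ξ * x : ℝ))) := by
  have hre (n : ℕ) : (2 * n + 1 + Complex.I * ξ : ℂ).re = 2 * n + 1 := by simp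
  have hpos (n : ℕ) : 0 < (2 * n + 1 + Complex.I * ξ : ℂ).re := by rw [hre]; positivity
  have h := hasSum_integral_of_summable_integral_norm (μ := volume.restrict (Ioi (0 : ℝ)))
    (F := fun (n : ℕ) (x : ℝ) =>
      2 * ((x : ℂ) * Complex.exp (-(2 * n + 1 + Complex.I * ξ) * x)))
    (fun n => (integrableOn_mul_cexp_neg_mul (hpos n)).const_mul 2) ?_
  · convert! h using 1
    · ext n
      rw [integral_const_mul, integral_mul_cexp_neg_mul (hpos n)]
      ring
    · refine setIntegral_congr_fun measurableSet_Ioi fun x hx => ?_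
      exact (hasSum_two_mul_cexp_neg hx ξ).tsum_eq.symm
  · convert! summable_one_div_two_mul_add_one_sq.mul_left 2 using 1
    ext n
    have hn : (0 : ℝ) < 2 * n + 1 := by positivity
    have h2 := integral_mul_cexp_neg_mul (a := ((2 * n + 1 : ℝ) : ℂ)) (by simpa using hn)
    have h3 : ∫ x : ℝ in Ioi 0, x * Real.exp (-((2 * n + 1) * x)) = 1 / (2 * n + 1) ^ 2 := by
      have h4 : ∫ x : ℝ in Ioi 0, (x : ℂ) * Complex.exp (-((2 * n + 1 : ℝ) : ℂ) * x)
          = ((∫ x : ℝ in Ioi 0, x * Real.exp (-((2 * n + 1) * x)) : ℝ) : ℂ) := by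
        rw [← integral_complex_ofReal]
        push_cast
        simp only [neg_mul]
      rw [h4] at h2
      exact_mod_cast h2
    rw [← h3, ← integral_const_mul]
    refine setIntegral_congr_fun measurableSet_Ioi fun x hx => ?_
    rw [norm_mul, norm_ofReal_mul_cexp_neg_mul hx, hre]
    simp

lemma integrable_div_sinh :
    Integrable (fun x : ℝ => if x = 0 then (1 : ℝ) else x / Real.sinh x) := by
  have hm : Measurable (fun x : ℝ => if x = 0 then (1 : ℝ) else x / Real.sinh x) :=
    Measurable.ite (measurableSet_singleton 0) measurable_const
      (measurable_id.div Real.measurable_sinh)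
  refine (integrable_inv_one_add_sq.const_mul 8).mono' hm.aestronglyMeasurable
    (Eventually.of_forall fun x => ?_)
  have key : ∀ y : ℝ, 0 < y → ‖y / Real.sinh y‖ ≤ 8 * (1 + y ^ 2)⁻¹ := by
    intro y hy
    have h1 : y / 4 ≤ Real.sinh (y / 4) := Real.self_le_sinh_iff.mpr (by positivity)
    have h2 : y / 2 ≤ Real.sinh (y / 2) := Real.self_le_sinh_iff.mpr (by positivity)
    have h3 : Real.sinh y = 2 * Real.sinh (y / 2) * Real.cosh (y / 2) := by
      rw [← Real.sinh_two_mul]; ring_nf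
    have h4 : Real.cosh (y / 2) = 1 + 2 * Real.sinh (y / 4) ^ 2 := by
      have := Real.cosh_two_mul (y / 4)
      rw [Real.cosh_sq, show 2 * (y / 4) = y / 2 by ring] at this
      linarith
    have h5 : 1 + y ^ 2 / 8 ≤ Real.cosh (y / 2) := by
      rw [h4]; nlinarith
    have h6 : y * (1 + y ^ 2 / 8) ≤ Real.sinh y := by
      rw [h3]
      exact mul_le_mul (by linarith) h5 (by positivity) (by linarith)
    have h7 : 0 < Real.sinh y := Real.sinh_pos_iff.mpr hy
    rw [Real.norm_of_nonneg (by positivity), ← div_eq_mul_inv, div_le_div_iff₀ h7 (by positivity)]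
    nlinarith
  rcases lt_trichotomy x 0 with hx | rfl | hx
  · simpa [hx.ne] using key (-x) (by linarith)
  · norm_num
  · simpa [hx.ne'] using key x hx

lemma tsum_int_one_div_add_sq {z : ℂ} (hz : 0 < z.im) :
    ∑' n : ℤ, 1 / (z + n) ^ 2 = Real.pi ^ 2 / Complex.sin (Real.pi * z) ^ 2 := by
  have hs : Complex.sin (Real.pi * z) ≠ 0 :=
    sin_pi_mul_ne_zero (UpperHalfPlane.coe_mem_integerComplement ⟨z, hz⟩)
  have h := iteratedDerivWithin_cot_pi_mul_eq_mul_tsum_div_pow (k := 1) le_rfl (z := z) hz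
  rw [iteratedDerivWithin_one,
    derivWithin_of_isOpen UpperHalfPlane.isOpen_upperHalfPlaneSet hz] at h
  have hd : HasDerivAt (fun x : ℂ => Real.pi * Complex.cot (Real.pi * x))
      (-(Real.pi ^ 2 / Complex.sin (Real.pi * z) ^ 2)) z := by
    have h1 : HasDerivAt (fun x : ℂ => Real.pi * x) Real.pi z := by
      simpa using (hasDerivAt_id z).const_mul (Real.pi : ℂ)
    convert! (h1.ccos.div h1.csin hs).const_mul (Real.pi : ℂ) using 1
    have := Complex.sin_sq_add_cos_sq (Real.pi * z)
    field_simp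
    linear_combination this
  rw [hd.deriv] at h
  norm_num at h
  simpa using h.symm

lemma norm_div_sinh_mul_cexp_le (ξ x : ℝ) :
    ‖((if x = 0 then (1 : ℝ) else x / Real.sinh x) : ℂ) *
        Complex.exp (-Complex.I * (ξ * x : ℝ))‖ ≤
      ‖if x = 0 then (1 : ℝ) else x / Real.sinh x‖ := by
  rw [norm_mul, Complex.norm_exp]
  split_ifs <;> simp [-Complex.ofReal_sinh]

lemma integrable_div_sinh_mul_cexp (ξ : ℝ) :
    Integrable (fun x : ℝ => ((if x = 0 then (1 : ℝ) else x / Real.sinh x) : ℂ) *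
        Complex.exp (-Complex.I * (ξ * x : ℝ))) := by
  refine Integrable.mono' integrable_div_sinh.norm ?_
    (Eventually.of_forall (norm_div_sinh_mul_cexp_le ξ))
  refine AEStronglyMeasurable.mul ?_ (by fun_prop)
  convert! integrable_div_sinh.ofReal (𝕜 := ℂ) |>.aestronglyMeasurable using 2 with x
  split_ifs <;> simp

lemma integral_div_sinh_eq_add (ξ : ℝ) :
    ∫ x : ℝ, ((if x = 0 then (1 : ℝ) else x / Real.sinh x) : ℂ) *
        Complex.exp (-Complex.I * (ξ * x : ℝ)) =
      (∫ x : ℝ in Ioi 0,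
        (x : ℂ) / (Real.sinh x : ℝ) * Complex.exp (-Complex.I * (ξ * x : ℝ))) +
      ∫ x : ℝ in Ioi 0,
        (x : ℂ) / (Real.sinh x : ℝ) * Complex.exp (-Complex.I * ((-ξ) * x : ℝ)) := by
  have hi := integrable_div_sinh_mul_cexp ξ
  rw [← intervalIntegral.integral_Iic_add_Ioi (b := 0) hi.integrableOn hi.integrableOn, add_comm]
  congr 1
  · refine setIntegral_congr_fun measurableSet_Ioi fun x hx => ?_
    simp [ne_of_gt (mem_Ioi.mp hx)]
  · rw [← neg_zero, ← integral_comp_neg_Ioi, neg_zero]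
    refine setIntegral_congr_fun measurableSet_Ioi fun x hx => ?_
    simp [ne_of_gt (mem_Ioi.mp hx)]

lemma integral_div_sinh_of_pos {ξ : ℝ} (hξ : 0 < ξ) :
    ∫ x : ℝ, ((if x = 0 then (1 : ℝ) else x / Real.sinh x) : ℂ) *
        Complex.exp (-Complex.I * (ξ * x : ℝ))
      = (Real.pi ^ 2 / (1 + Real.cosh (Real.pi * ξ)) : ℝ) := by
  set z : ℂ := (1 + Complex.I * ξ) / 2 with hz
  have hzim : 0 < z.im := by simp [hz, hξ]
  have hsum : HasSum (fun n : ℤ => 1 / 2 * (1 / (z + n) ^ 2)) _ :=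
    HasSum.of_nat_of_neg_add_one
      (f := fun n : ℤ => 1 / 2 * (1 / (z + n) ^ 2))
      (by
        convert! hasSum_integral_Ioi_div_sinh ξ using 2 with n
        rw [show (2 * n + 1 + Complex.I * ξ : ℂ) = 2 * (z + (n : ℤ)) by
          rw [hz]; push_cast; ring]
        rw [mul_pow, ← div_div]
        ring)
      (by
        convert! hasSum_integral_Ioi_div_sinh (-ξ) using 2 with n
        rw [show (2 * n + 1 + Complex.I * (-ξ : ℝ) : ℂ) = -2 * (z + (-((n : ℤ) + 1) : ℤ)) by
          rw [hz]; push_cast; ring]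
        rw [mul_pow, ← div_div]
        ring)
  rw [integral_div_sinh_eq_add, ← hsum.tsum_eq, tsum_mul_left, tsum_int_one_div_add_sq hzim]
  have h1 : Complex.sin (Real.pi * z) = Complex.cosh (Real.pi * ξ / 2) := by
    rw [show (Real.pi * z : ℂ) = (Real.pi * ξ / 2) * Complex.I + Real.pi / 2 by rw [hz]; ring,
      Complex.sin_add_pi_div_two, Complex.cos_mul_I]
  have h2 : 1 + Complex.cosh (Real.pi * ξ) = 2 * Complex.cosh (Real.pi * ξ / 2) ^ 2 := by
    have := Complex.cosh_two_mul (Real.pi * ξ / 2)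
    rw [Complex.sinh_sq, show (2 * (Real.pi * ξ / 2) : ℂ) = Real.pi * ξ by ring] at this
    rw [this]; ring
  rw [h1]
  push_cast
  rw [h2, ← div_div]
  ring

/-- The Fourier transform of `x/sinh x` (extended by `1` at `x = 0`) is
`π²/(1 + cosh(πξ))`. -/
theorem fourier_transform_x_div_sinh (ξ : ℝ) :
    Integrable (fun x : ℝ => if x = 0 then (1 : ℝ) else x / Real.sinh x) ∧
    ∫ x : ℝ, ((if x = 0 then (1 : ℝ) else x / Real.sinh x) : ℂ) *
        Complex.exp (-Complex.I * (ξ * x : ℝ))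
      = (Real.pi ^ 2 / (1 + Real.cosh (Real.pi * ξ)) : ℝ) := by
  refine ⟨integrable_div_sinh, ?_⟩
  have hL : Continuous fun ξ : ℝ =>
      ∫ x : ℝ, ((if x = 0 then (1 : ℝ) else x / Real.sinh x) : ℂ) *
        Complex.exp (-Complex.I * (ξ * x : ℝ)) := by
    exact continuous_of_dominated (fun ξ => (integrable_div_sinh_mul_cexp ξ).1)
      (fun ξ => Eventually.of_forall (norm_div_sinh_mul_cexp_le ξ)) integrable_div_sinh.norm
      (Eventually.of_forall fun x => by fun_prop)
  have hR : Continuous fun ξ : ℝ =>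
      ((Real.pi ^ 2 / (1 + Real.cosh (Real.pi * ξ)) : ℝ) : ℂ) := by
    refine Complex.continuous_ofReal.comp (continuous_const.div (by fun_prop) fun ξ => ?_)
    have := Real.cosh_pos (Real.pi * ξ)
    positivity
  refine congrFun (hL.ext_on (dense_compl_singleton (0 : ℝ)) hR fun ξ hξ => ?_) ξ
  rcases lt_or_gt_of_ne (mem_compl_singleton_iff.mp hξ) with h | h
  · have := integral_div_sinh_of_pos (neg_pos.mpr h)
    rw [integral_div_sinh_eq_add, neg_neg, mul_neg, Real.cosh_neg] at this
    beta_reduce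
    rw [← this, integral_div_sinh_eq_add, add_comm]
  · exact integral_div_sinh_of_pos h
end

section
/- Poisson summation formula for the Heisenberg heat trace: for every real z > 0, ∑_{m=1}^∞ m/sinh(2mz) = π²/(16 z²) − 1/(4z) + (π²/(4z²)) ∑_{n=1}^∞ 1/(1 + cosh(π²n/z)), and both series converge. -/
open scoped ArithmeticFunction.sigma in
/-- The Lambert series `∑ σ₁(n) rⁿ`. -/
noncomputable def sigmaSeries (r : ℝ) : ℝ :=
  ∑' n : ℕ+, (σ 1 (n : ℕ) : ℝ) * r ^ (n : ℕ)

lemma hasSum_mul_pow_div_one_sub_pow {r : ℝ} (hr : ‖r‖ < 1) :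
    HasSum (fun n : ℕ => (n + 1 : ℝ) * r ^ (n + 1) / (1 - r ^ (n + 1))) (sigmaSeries r) := by
  have hs := summable_norm_pow_mul_geometric_div_one_sub 1 hr
  have hs' := ((summable_nat_add_iff 1).mpr hs).hasSum
  rw [← tsum_pnat_eq_tsum_succ (f := fun n : ℕ => (n : ℝ) ^ 1 * r ^ n / (1 - r ^ n)),
    tsum_pow_div_one_sub_eq_tsum_sigma hr 1] at hs'
  simpa [sigmaSeries] using hs'

lemma hasSum_pow_div_one_sub_pow_sq {r : ℝ} (hr : ‖r‖ < 1) :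
    HasSum (fun n : ℕ => r ^ (n + 1) / (1 - r ^ (n + 1)) ^ 2) (sigmaSeries r) := by
  have hfib (d : ℕ+) : HasSum (fun c : ℕ+ => (c : ℝ) ^ 1 * r ^ (d * c : ℕ))
      (r ^ (d : ℕ) / (1 - r ^ (d : ℕ)) ^ 2) := by
    have hd : ‖r ^ (d : ℕ)‖ < 1 := by
      rw [norm_pow]
      exact pow_lt_one₀ (norm_nonneg r) hr d.ne_zero
    have h := hasSum_coe_mul_geometric_of_norm_lt_one hd
    rw [← hasSum_nat_add_iff' 1] at h
    rw [← Equiv.pnatEquivNat.symm.hasSum_iff]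
    simpa [Function.comp_def, pow_mul] using h
  have hs := (summable_prod_mul_pow 1 hr).hasSum
  have h := hs.prod_fiberwise hfib
  rw [(summable_prod_mul_pow 1 hr).tsum_prod, tsum_prod_pow_eq_tsum_sigma 1 hr] at h
  rw [← Equiv.pnatEquivNat.symm.hasSum_iff] at h
  simpa [Function.comp_def, sigmaSeries] using h

open Complex in
lemma G2_mul_I (t : ℝ) (τ : UpperHalfPlane) (hτ : (τ : ℂ) = t * I) :
    EisensteinSeries.G2 τ
      = ((Real.pi ^ 2 / 3
          - 8 * Real.pi ^ 2 * sigmaSeries (Real.exp (-(2 * Real.pi * t))) : ℝ) : ℂ) := by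
  have hexp : cexp (2 * Real.pi * I * (t * I)) = (Real.exp (-(2 * Real.pi * t)) : ℂ) := by
    rw [ofReal_exp]
    congr 1
    push_cast
    linear_combination (2 * Real.pi * t : ℂ) * I_sq
  rw [EisensteinSeries.G2_eq_tsum_cexp, hτ, hexp, riemannZeta_two, sigmaSeries]
  push_cast
  ring

/-- The transformation law of the weight two Eisenstein series on the imaginary axis. -/
lemma sigmaSeries_exp_inversion {t : ℝ} (ht : 0 < t) :
    Real.pi ^ 2 / 3 - 8 * Real.pi ^ 2 * sigmaSeries (Real.exp (-(2 * Real.pi * t))) =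
      2 * Real.pi / t - (Real.pi ^ 2 / 3
        - 8 * Real.pi ^ 2 * sigmaSeries (Real.exp (-(2 * Real.pi * t⁻¹)))) / t ^ 2 := by
  have ht' : (t : ℂ) ≠ 0 := by exact_mod_cast ht.ne'
  let τ : UpperHalfPlane := ⟨t * Complex.I, by simpa using ht⟩
  have hτ : (τ : ℂ) = t * Complex.I := rfl
  have hS : ((ModularGroup.S • τ : UpperHalfPlane) : ℂ) = (t⁻¹ : ℝ) * Complex.I := by
    rw [UpperHalfPlane.modular_S_smul]
    simp [hτ, mul_comm]
  have h := EisensteinSeries.G2_S_transform τ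
  rw [G2_mul_I t τ hτ, G2_mul_I t⁻¹ _ hS, hτ] at h
  rw [← Complex.ofReal_inj, h, mul_pow, Complex.I_sq]
  push_cast
  field_simp
  ring

lemma div_sinh_eq (m z : ℝ) (h : 0 < m * z) :
    m / Real.sinh (2 * m * z) =
      2 * (m * Real.exp (-(2 * m * z)) / (1 - Real.exp (-(2 * m * z)))
        - m * Real.exp (-(2 * m * z)) ^ 2 / (1 - Real.exp (-(2 * m * z)) ^ 2)) := by
  have hx : Real.exp (-(2 * m * z)) < 1 := Real.exp_lt_one_iff.mpr (by linarith)
  have h0 := Real.exp_pos (-(2 * m * z))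
  rw [Real.sinh_eq, ← neg_neg (2 * m * z), Real.exp_neg (-(2 * m * z)), neg_neg]
  generalize Real.exp (-(2 * m * z)) = x at *
  have h1 : 1 - x ≠ 0 := by linarith
  rw [show x⁻¹ - x = (1 - x ^ 2) / x by field_simp,
    show 1 - x ^ 2 = (1 - x) * (1 + x) by ring]
  have h4 : 1 + x ≠ 0 := by linarith
  field_simp
  ring

lemma one_div_one_add_cosh_eq {y : ℝ} (hy : 0 < y) :
    1 / (1 + Real.cosh y) =
      2 * (Real.exp (-y) / (1 - Real.exp (-y)) ^ 2
        - 4 * (Real.exp (-y) ^ 2 / (1 - Real.exp (-y) ^ 2) ^ 2)) := by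
  have hx : Real.exp (-y) < 1 := Real.exp_lt_one_iff.mpr (by linarith)
  have h0 := Real.exp_pos (-y)
  rw [Real.cosh_eq, ← neg_neg y, Real.exp_neg (-y), neg_neg]
  generalize Real.exp (-y) = x at *
  have h1 : 1 - x ≠ 0 := by linarith
  have h4 : 1 + x ≠ 0 := by linarith
  rw [show 1 + (x⁻¹ + x) / 2 = (1 + x) ^ 2 / (2 * x) by field_simp; ring,
    show 1 - x ^ 2 = (1 - x) * (1 + x) by ring]
  field_simp
  ring

lemma norm_exp_neg_lt_one {y : ℝ} (hy : 0 < y) : ‖Real.exp (-y)‖ < 1 := by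
  simpa using hy

lemma hasSum_div_sinh {z : ℝ} (hz : 0 < z) :
    HasSum (fun m : ℕ => (m + 1 : ℝ) / Real.sinh (2 * (m + 1) * z))
      (2 * (sigmaSeries (Real.exp (-(2 * z))) - sigmaSeries (Real.exp (-(4 * z))))) := by
  have h1 := hasSum_mul_pow_div_one_sub_pow (norm_exp_neg_lt_one (y := 2 * z) (by positivity))
  have h2 := hasSum_mul_pow_div_one_sub_pow (norm_exp_neg_lt_one (y := 4 * z) (by positivity))
  refine ((h1.sub h2).mul_left 2).congr_fun fun m => ?_
  rw [div_sinh_eq _ _ (by positivity)]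
  simp only [← Real.exp_nat_mul]
  push_cast
  ring_nf

lemma hasSum_one_div_one_add_cosh {y : ℝ} (hy : 0 < y) :
    HasSum (fun n : ℕ => 1 / (1 + Real.cosh (y * (n + 1))))
      (2 * (sigmaSeries (Real.exp (-y)) - 4 * sigmaSeries (Real.exp (-(2 * y))))) := by
  have h1 := hasSum_pow_div_one_sub_pow_sq (norm_exp_neg_lt_one hy)
  have h2 := hasSum_pow_div_one_sub_pow_sq (norm_exp_neg_lt_one (y := 2 * y) (by positivity))
  refine ((h1.sub (h2.mul_left 4)).mul_left 2).congr_fun fun n => ?_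
  rw [one_div_one_add_cosh_eq (by positivity)]
  simp only [← Real.exp_nat_mul]
  push_cast
  ring_nf

/-- Poisson summation for the Heisenberg heat trace:
`∑_{m≥1} m/sinh(2mz) = π²/(16z²) − 1/(4z) + (π²/(4z²)) ∑_{n≥1} 1/(1 + cosh(π²n/z))`. -/
theorem heis_heat_trace_poisson (z : ℝ) (hz : 0 < z) :
    Summable (fun m : ℕ => (m + 1 : ℝ) / Real.sinh (2 * (m + 1) * z)) ∧
    Summable (fun n : ℕ => 1 / (1 + Real.cosh (Real.pi ^ 2 * (n + 1) / z))) ∧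
    ∑' m : ℕ, (m + 1 : ℝ) / Real.sinh (2 * (m + 1) * z)
      = Real.pi ^ 2 / (16 * z ^ 2) - 1 / (4 * z) +
        Real.pi ^ 2 / (4 * z ^ 2) *
          ∑' n : ℕ, 1 / (1 + Real.cosh (Real.pi ^ 2 * (n + 1) / z)) := by
  have hL := hasSum_div_sinh hz
  have hR : HasSum (fun n : ℕ => 1 / (1 + Real.cosh (Real.pi ^ 2 * (n + 1) / z)))
      (2 * (sigmaSeries (Real.exp (-(Real.pi ^ 2 / z)))
        - 4 * sigmaSeries (Real.exp (-(2 * (Real.pi ^ 2 / z)))))) := by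
    refine (hasSum_one_div_one_add_cosh (y := Real.pi ^ 2 / z) (by positivity)).congr_fun
      fun n => ?_
    rw [div_mul_eq_mul_div]
  refine ⟨hL.summable, hR.summable, ?_⟩
  rw [hL.tsum_eq, hR.tsum_eq]
  have e1 := sigmaSeries_exp_inversion (t := z / Real.pi) (by positivity)
  have e2 := sigmaSeries_exp_inversion (t := 2 * z / Real.pi) (by positivity)
  rw [show 2 * Real.pi * (z / Real.pi) = 2 * z by field_simp,
    show 2 * Real.pi * (z / Real.pi)⁻¹ = 2 * (Real.pi ^ 2 / z) by field_simp] at e1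
  rw [show 2 * Real.pi * (2 * z / Real.pi) = 4 * z by field_simp; norm_num,
    show 2 * Real.pi * (2 * z / Real.pi)⁻¹ = Real.pi ^ 2 / z by field_simp] at e2
  generalize sigmaSeries (Real.exp (-(2 * z))) = a at *
  generalize sigmaSeries (Real.exp (-(4 * z))) = b at *
  generalize sigmaSeries (Real.exp (-(Real.pi ^ 2 / z))) = c at *
  generalize sigmaSeries (Real.exp (-(2 * (Real.pi ^ 2 / z)))) = d at *
  have key : (8 * Real.pi ^ 2) * (a - b) = (8 * Real.pi ^ 2) * (1 / 2 * (Real.pi ^ 2 / (16 * z ^ 2)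
      - 1 / (4 * z) + Real.pi ^ 2 / (4 * z ^ 2) * (2 * (c - 4 * d)))) := by
    have e : (8 * Real.pi ^ 2) * (a - b) = (Real.pi ^ 2 / 3 - 8 * Real.pi ^ 2 * b) -
        (Real.pi ^ 2 / 3 - 8 * Real.pi ^ 2 * a) := by ring
    rw [e, e1, e2]
    field_simp
    ring
  have := mul_left_cancel₀ (by positivity) key
  linarith
end

section
/- Exponential smallness of the heat-trace remainder: for every ε > 0, lim_{z → 0⁺} e^{(π²−ε)/z} · ( ∑_{m=1}^∞ m/sinh(2mz) − π²/(16 z²) + 1/(4z) ) = 0. In particular the remainder beyond the Weyl term π²/(16z²) − 1/(4z) is of order exp(−L²/4z) with L = 2π the length of the shortest closed geodesic, as in the Riemannian case. -/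
open Filter

/-- The Lambert series `∑_{n ≥ 1} n qⁿ / (1 - qⁿ)`. -/
noncomputable def lambertSum (q : ℝ) : ℝ :=
  ∑' n : ℕ, ((n : ℝ) + 1) * q ^ (n + 1) / (1 - q ^ (n + 1))

theorem summable_lambertSum {q : ℝ} (h0 : 0 ≤ q) (h1 : q < 1) :
    Summable fun n : ℕ => ((n : ℝ) + 1) * q ^ (n + 1) / (1 - q ^ (n + 1)) := by
  have h := summable_norm_pow_mul_geometric_div_one_sub (𝕜 := ℝ) 1
    (r := q) (by rwa [Real.norm_of_nonneg h0])
  simpa using (summable_nat_add_iff 1).mpr h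

theorem G2_eq_lambertSum (z : UpperHalfPlane) (t : ℝ) (hz : (z : ℂ) = Complex.I * t) :
    EisensteinSeries.G2 z =
      ((Real.pi ^ 2 / 3 - 8 * Real.pi ^ 2 * lambertSum (Real.exp (-(2 * Real.pi * t))) : ℝ) : ℂ) := by
  have hq : Complex.exp (2 * Real.pi * Complex.I * z) =
      ((Real.exp (-(2 * Real.pi * t)) : ℝ) : ℂ) := by
    rw [hz, Complex.ofReal_exp]
    congr 1
    push_cast
    linear_combination (2 * Real.pi * t : ℂ) * Complex.I_mul_I
  rw [EisensteinSeries.G2_eq_tsum_cexp, riemannZeta_two, ← tsum_pow_div_one_sub_eq_tsum_sigma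
    (UpperHalfPlane.norm_exp_two_pi_I_lt_one z), hq,
    tsum_pnat_eq_tsum_succ (f := fun n : ℕ => (n : ℂ) ^ 1 *
      ((Real.exp (-(2 * Real.pi * t)) : ℝ) : ℂ) ^ n /
      (1 - ((Real.exp (-(2 * Real.pi * t)) : ℝ) : ℂ) ^ n)), lambertSum]
  push_cast
  simp only [pow_one]
  ring

/-- The transformation law of `E₂` under `τ ↦ -1/τ`, on the imaginary axis. -/
theorem lambertSum_transform {t : ℝ} (ht : 0 < t) :
    1 - 24 * lambertSum (Real.exp (-(2 * Real.pi * t))) =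
      6 / (Real.pi * t) - (1 - 24 * lambertSum (Real.exp (-(2 * Real.pi * t⁻¹)))) / t ^ 2 := by
  let z : UpperHalfPlane := ⟨Complex.I * t, by simpa using ht⟩
  have hz : (z : ℂ) = Complex.I * t := rfl
  have ht' : (t : ℂ) ≠ 0 := by exact_mod_cast ht.ne'
  have hS : ((ModularGroup.S • z : UpperHalfPlane) : ℂ) = Complex.I * (t⁻¹ : ℝ) := by
    rw [UpperHalfPlane.modular_S_smul]
    change (-(z : ℂ))⁻¹ = _
    rw [hz]
    push_cast
    rw [← neg_mul, mul_inv, ← Complex.inv_I, inv_inv]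
  have h := EisensteinSeries.G2_S_transform z
  rw [G2_eq_lambertSum z t hz, G2_eq_lambertSum _ _ hS, hz] at h
  set A := lambertSum (Real.exp (-(2 * Real.pi * t)))
  set B := lambertSum (Real.exp (-(2 * Real.pi * t⁻¹)))
  have h' : Real.pi ^ 2 / 3 - 8 * Real.pi ^ 2 * A =
      -(t ^ 2)⁻¹ * (Real.pi ^ 2 / 3 - 8 * Real.pi ^ 2 * B) + 2 * Real.pi / t := by
    apply Complex.ofReal_injective
    rw [h]
    push_cast
    rw [mul_pow, Complex.I_sq]
    have hI := Complex.I_ne_zero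
    field_simp
    ring
  have hpi := Real.pi_ne_zero
  field_simp at h' ⊢
  linear_combination h'

theorem inv_sinh_eq {x : ℝ} (hx : 0 < x) :
    (Real.sinh x)⁻¹ = 2 * (Real.exp (-x) / (1 - Real.exp (-x)) -
      Real.exp (-x) ^ 2 / (1 - Real.exp (-x) ^ 2)) := by
  have hq : Real.exp (-x) < 1 := by simpa using hx
  have hq0 := Real.exp_pos (-x)
  rw [Real.sinh_eq, ← inv_inv (Real.exp x), ← Real.exp_neg]
  set q := Real.exp (-x)
  have h1 : 1 - q ≠ 0 := by linarith
  have h2 : 1 - q ^ 2 ≠ 0 := by nlinarith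
  have h3 : q⁻¹ - q ≠ 0 := by
    rw [show q⁻¹ - q = (1 - q ^ 2) / q by field_simp]
    exact div_ne_zero h2 hq0.ne'
  have h4 : 1 + q ≠ 0 := by linarith
  rw [show q⁻¹ - q = (1 - q) * (1 + q) / q by field_simp; ring,
    show 1 - q ^ 2 = (1 - q) * (1 + q) by ring]
  field_simp
  ring

theorem tsum_div_sinh_eq {z : ℝ} (hz : 0 < z) :
    ∑' m : ℕ, (m + 1 : ℝ) / Real.sinh (2 * (m + 1) * z) =
      2 * (lambertSum (Real.exp (-(2 * z))) - lambertSum (Real.exp (-(4 * z)))) := by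
  have hs1 := summable_lambertSum (Real.exp_pos (-(2 * z))).le (by simpa using hz)
  have hs2 := summable_lambertSum (Real.exp_pos (-(4 * z))).le (by simpa using hz)
  rw [lambertSum, lambertSum, ← hs1.tsum_sub hs2, ← tsum_mul_left]
  refine tsum_congr fun m => ?_
  rw [div_eq_mul_inv, inv_sinh_eq (by positivity)]
  have e1 : Real.exp (-(2 * z)) ^ (m + 1) = Real.exp (-(2 * (m + 1) * z)) := by
    rw [← Real.exp_nat_mul]; push_cast; ring_nf
  have e2 : Real.exp (-(4 * z)) ^ (m + 1) = Real.exp (-(2 * (m + 1) * z)) ^ 2 := by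
    rw [← Real.exp_nat_mul, ← Real.exp_nat_mul]; push_cast; ring_nf
  rw [e1, e2]
  ring

theorem exists_lambertSum_le :
    ∃ C : ℝ, ∀ q : ℝ, 0 ≤ q → q ≤ 1 / 2 → |lambertSum q| ≤ C * q := by
  have hs : Summable fun n : ℕ => 2 * (((n : ℝ) + 1) * (1 / 2) ^ n) := by
    have h := summable_norm_pow_mul_geometric_of_norm_lt_one (R := ℝ) 1
      (r := 1 / 2) (by norm_num)
    have h' := ((summable_nat_add_iff 1).mpr h.of_norm).mul_left 4
    refine h'.congr fun n => ?_
    push_cast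
    ring
  refine ⟨∑' n : ℕ, 2 * (((n : ℝ) + 1) * (1 / 2) ^ n), fun q h0 h1 => ?_⟩
  rw [← tsum_mul_right, lambertSum, ← Real.norm_eq_abs]
  refine tsum_of_norm_bounded (hs.mul_right q).hasSum fun n => ?_
  have hq : q ^ (n + 1) ≤ 1 / 2 :=
    (pow_le_of_le_one h0 (by linarith) n.succ_ne_zero).trans h1
  have hn : q ^ n ≤ (1 / 2) ^ n := pow_le_pow_left₀ h0 h1 n
  rw [Real.norm_of_nonneg (div_nonneg (by positivity) (by linarith)),
    div_le_iff₀ (by linarith)]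
  calc ((n : ℝ) + 1) * q ^ (n + 1) = 2 * ((n + 1) * q ^ n) * q * (1 / 2) := by ring
    _ ≤ 2 * ((n + 1) * (1 / 2) ^ n) * q * (1 - q ^ (n + 1)) := by
      gcongr
      linarith

/-- The remainder beyond the Weyl term, expressed by Lambert series at the dual parameter. -/
theorem heat_trace_remainder_eq {z : ℝ} (hz : 0 < z) :
    (∑' m : ℕ, (m + 1 : ℝ) / Real.sinh (2 * (m + 1) * z)) -
        Real.pi ^ 2 / (16 * z ^ 2) + 1 / (4 * z) =
      Real.pi ^ 2 / z ^ 2 * (lambertSum (Real.exp (-(Real.pi ^ 2 / z))) / 2 -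
        2 * lambertSum (Real.exp (-(2 * Real.pi ^ 2 / z)))) := by
  have hpi := Real.pi_pos
  have h1 := lambertSum_transform (t := z / Real.pi) (by positivity)
  have h2 := lambertSum_transform (t := 2 * z / Real.pi) (by positivity)
  rw [show 2 * Real.pi * (z / Real.pi) = 2 * z by field_simp,
    show 2 * Real.pi * (z / Real.pi)⁻¹ = 2 * Real.pi ^ 2 / z by field_simp] at h1
  rw [show 2 * Real.pi * (2 * z / Real.pi) = 4 * z by field_simp; norm_num,
    show 2 * Real.pi * (2 * z / Real.pi)⁻¹ = Real.pi ^ 2 / z by field_simp] at h2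
  rw [tsum_div_sinh_eq hz]
  field_simp at h1 h2 ⊢
  linarith

/-- Exponential smallness of the heat-trace remainder beyond the Weyl term:
for every `ε > 0`,
`e^{(π²−ε)/z} (∑_{m≥1} m/sinh(2mz) − π²/(16z²) + 1/(4z)) → 0` as `z → 0⁺`. -/
theorem heis_heat_trace_remainder (ε : ℝ) (hε : 0 < ε) :
    Tendsto (fun z : ℝ =>
        Real.exp ((Real.pi ^ 2 - ε) / z) *
          ((∑' m : ℕ, (m + 1 : ℝ) / Real.sinh (2 * (m + 1) * z)) -
            Real.pi ^ 2 / (16 * z ^ 2) + 1 / (4 * z)))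
      (nhdsWithin 0 (Set.Ioi 0)) (nhds 0) := by
  obtain ⟨C, hC⟩ := exists_lambertSum_le
  have hinv : Tendsto (fun z : ℝ => z⁻¹) (nhdsWithin 0 (Set.Ioi 0)) atTop :=
    tendsto_inv_nhdsGT_zero
  have hlim : Tendsto (fun z : ℝ => 5 / 2 * C * Real.pi ^ 2 *
      (z⁻¹ ^ (2 : ℝ) * Real.exp (-ε * z⁻¹))) (nhdsWithin 0 (Set.Ioi 0)) (nhds 0) := by
    simpa using ((tendsto_rpow_mul_exp_neg_mul_atTop_nhds_zero 2 ε hε).comp hinv).const_mul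
      (5 / 2 * C * Real.pi ^ 2)
  have hsmall : ∀ᶠ z : ℝ in nhdsWithin 0 (Set.Ioi 0),
      Real.exp (-(Real.pi ^ 2 / z)) ≤ 1 / 2 := by
    have h : Tendsto (fun z : ℝ => Real.exp (-(Real.pi ^ 2 * z⁻¹)))
        (nhdsWithin 0 (Set.Ioi 0)) (nhds 0) :=
      Real.tendsto_exp_neg_atTop_nhds_zero.comp (hinv.const_mul_atTop (by positivity))
    simpa only [div_eq_mul_inv, one_mul] using h.eventually_le_const (by norm_num : (0 : ℝ) < 2⁻¹)
  refine squeeze_zero_norm' ?_ hlim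
  filter_upwards [hsmall, self_mem_nhdsWithin] with z hq hz
  have hz : 0 < z := hz
  rw [heat_trace_remainder_eq hz]
  have hle : Real.exp (-(2 * Real.pi ^ 2 / z)) ≤ Real.exp (-(Real.pi ^ 2 / z)) := by
    gcongr
    nlinarith [sq_nonneg Real.pi]
  have h1 := hC _ (Real.exp_pos _).le hq
  have h2 := hC _ (Real.exp_pos _).le (hle.trans hq)
  have hC0 : 0 ≤ C := by
    by_contra! h
    nlinarith [abs_nonneg (lambertSum (Real.exp (-(Real.pi ^ 2 / z)))),
      Real.exp_pos (-(Real.pi ^ 2 / z))]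
  have h3 : |lambertSum (Real.exp (-(Real.pi ^ 2 / z))) / 2 -
      2 * lambertSum (Real.exp (-(2 * Real.pi ^ 2 / z)))| ≤
      5 / 2 * C * Real.exp (-(Real.pi ^ 2 / z)) := by
    have h4 := mul_le_mul_of_nonneg_left hle hC0
    rw [abs_le] at h1 h2 ⊢
    constructor <;> linarith
  rw [Real.norm_eq_abs, abs_mul, abs_mul, Real.abs_exp, abs_of_nonneg (by positivity)]
  calc _ ≤ Real.exp ((Real.pi ^ 2 - ε) / z) * (Real.pi ^ 2 / z ^ 2 *
        (5 / 2 * C * Real.exp (-(Real.pi ^ 2 / z)))) := by gcongr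
    _ = 5 / 2 * C * Real.pi ^ 2 * (z⁻¹ ^ (2 : ℝ) *
        (Real.exp ((Real.pi ^ 2 - ε) / z) * Real.exp (-(Real.pi ^ 2 / z)))) := by
      rw [Real.rpow_two]
      ring
    _ = _ := by
      rw [← Real.exp_add]
      ring_nf
end
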